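/- For every s ∈ ℂ ∖ {−1, −2, −3, …}, the determinant Δ(s) of the d×d matrix whose (k, l) entry (1 ≤ k, l ≤ d) is F_{k−1}(s+l) is nonzero; equivalently, the d vectors (F_0(s+l), F_1(s+l), …, F_{d−1}(s+l)) ∈ ℂ^d, for l = 1, …, d, are linearly independent. -/

import Mathlib

/-- The polynomial `P₀(t) = -t^d/d + ∑_{k=1}^{d-1} a_k t^k`. -/
noncomputable def P0 (d : ℕ) (a : ℕ → ℂ) (t : ℂ) : ℂ :=
  -t ^ d / (d : ℂ) + ∑ k ∈ Finset.Ico 1 d, a k * t ^ k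

/-- The Omega function `Ω_k(s) = e^{2πiks/d} ∫_0^∞ u^{s-1} e^{P₀(ω_k u)} du`, for `Re s > 0`,
where `ω_k = e^{2πik/d}` and `u^{s-1} = exp((s-1) log u)` for real `u > 0`. -/
noncomputable def OmegaFn (d : ℕ) (a : ℕ → ℂ) (k : ℕ) (s : ℂ) : ℂ :=
  Complex.exp (2 * Real.pi * Complex.I * k * s / d) *
    ∫ u in Set.Ioi (0 : ℝ),
      (u : ℂ) ^ (s - 1) *
        Complex.exp (P0 d a (Complex.exp (2 * Real.pi * Complex.I * k / d) * u))

open MeasureTheory Set Filter Topology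

theorem aestronglyMeasurable_pow_mul_exp_mul {h : ℝ → ℂ} (hcont : ContinuousOn h (Ioi 0))
    (m : ℕ) (z : ℂ) :
    AEStronglyMeasurable (fun v : ℝ => (v : ℂ) ^ m * Complex.exp (z * v) * h v)
      (volume.restrict (Ioi 0)) := by
  refine ContinuousOn.aestronglyMeasurable (ContinuousOn.mul ?_ hcont) measurableSet_Ioi
  fun_prop

theorem norm_pow_mul_exp_mul_le {c δ v : ℝ} (hδ : 0 < δ) (hv : 0 < v) (m : ℕ) {z : ℂ}
    (hz : z.re + δ ≤ c) (w : ℂ) :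
    ‖(v : ℂ) ^ m * Complex.exp (z * v) * w‖ ≤
      m.factorial / δ ^ m * (Real.exp (c * v) * ‖w‖) := by
  have h1 := Real.pow_div_factorial_le_exp (δ * v) (by positivity) m
  rw [norm_mul, norm_mul, norm_pow, Complex.norm_real, Complex.norm_exp, Real.norm_of_nonneg hv.le,
    ← mul_assoc]
  refine mul_le_mul_of_nonneg_right ?_ (norm_nonneg w)
  have h2 : v ^ m ≤ m.factorial / δ ^ m * Real.exp (δ * v) := by
    rw [div_mul_eq_mul_div, le_div_iff₀ (by positivity)]
    rw [div_le_iff₀ (by positivity), mul_pow] at h1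
    linarith
  have h3 : (z * (v : ℂ)).re = z.re * v := by simp
  rw [h3]
  calc v ^ m * Real.exp (z.re * v)
      ≤ m.factorial / δ ^ m * Real.exp (δ * v) * Real.exp (z.re * v) := by gcongr
    _ = m.factorial / δ ^ m * Real.exp ((z.re + δ) * v) := by
        rw [mul_assoc, ← Real.exp_add]; ring_nf
    _ ≤ _ := by gcongr

theorem integrableOn_pow_mul_exp_mul {h : ℝ → ℂ} (hcont : ContinuousOn h (Ioi 0)) {c : ℝ}
    (hint : IntegrableOn (fun v : ℝ => Real.exp (c * v) * ‖h v‖) (Ioi 0)) (m : ℕ) {z : ℂ}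
    (hz : z.re < c) :
    IntegrableOn (fun v : ℝ => (v : ℂ) ^ m * Complex.exp (z * v) * h v) (Ioi 0) := by
  refine Integrable.mono' (hint.const_mul (m.factorial / (c - z.re) ^ m))
    (aestronglyMeasurable_pow_mul_exp_mul hcont m z) ?_
  filter_upwards [ae_restrict_mem measurableSet_Ioi] with v hv
  exact norm_pow_mul_exp_mul_le (sub_pos.2 hz) hv m (by linarith) _

theorem hasDerivAt_integral_pow_mul_exp_mul {h : ℝ → ℂ} (hcont : ContinuousOn h (Ioi 0)) {c : ℝ}
    (hint : IntegrableOn (fun v : ℝ => Real.exp (c * v) * ‖h v‖) (Ioi 0)) (m : ℕ) {z : ℂ}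
    (hz : z.re < c) :
    HasDerivAt (fun z : ℂ => ∫ v in Ioi (0 : ℝ), (v : ℂ) ^ m * Complex.exp (z * v) * h v)
      (∫ v in Ioi (0 : ℝ), (v : ℂ) ^ (m + 1) * Complex.exp (z * v) * h v) z := by
  set δ := (c - z.re) / 2 with hδ
  have hδ0 : 0 < δ := by linarith
  refine (hasDerivAt_integral_of_dominated_loc_of_deriv_le
    (F' := fun (z : ℂ) (v : ℝ) => (v : ℂ) ^ (m + 1) * Complex.exp (z * v) * h v) (Metric.ball_mem_nhds z hδ0)
    (Eventually.of_forall fun w => aestronglyMeasurable_pow_mul_exp_mul hcont m w)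
    (integrableOn_pow_mul_exp_mul hcont hint m hz)
    (aestronglyMeasurable_pow_mul_exp_mul hcont (m + 1) z) ?_
    (hint.const_mul ((m + 1).factorial / δ ^ (m + 1))) ?_).2
  · filter_upwards [ae_restrict_mem measurableSet_Ioi] with v hv w hw
    refine norm_pow_mul_exp_mul_le hδ0 hv (m + 1) ?_ _
    have h1 := (Complex.abs_re_le_norm (w - z)).trans_lt (mem_ball_iff_norm.1 hw)
    rw [Complex.sub_re] at h1
    linarith [(abs_lt.1 h1).2]
  · refine Eventually.of_forall fun v w _ => ?_
    have h1 : HasDerivAt (fun w : ℂ => Complex.exp (w * v)) (Complex.exp (w * v) * (1 * v)) w :=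
      ((hasDerivAt_id w).mul_const (v : ℂ)).cexp
    refine ((h1.const_mul ((v : ℂ) ^ m)).mul_const (h v)).congr_deriv ?_
    ring

/-- A continuous function on the half-line with an exponential moment is determined by its
moments. -/
theorem eq_zero_of_forall_moment_eq_zero {h : ℝ → ℂ} (hcont : ContinuousOn h (Ioi 0)) {c : ℝ}
    (hc : 0 < c) (hint : IntegrableOn (fun v : ℝ => Real.exp (c * v) * ‖h v‖) (Ioi 0))
    (hmom : ∀ m : ℕ, ∫ v in Ioi (0 : ℝ), (v : ℂ) ^ m * h v = 0) {v : ℝ} (hv : 0 < v) :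
    h v = 0 := by
  set G : ℕ → ℂ → ℂ := fun m z => ∫ v in Ioi (0 : ℝ), (v : ℂ) ^ m * Complex.exp (z * v) * h v
    with hG
  have hopen : IsOpen {z : ℂ | z.re < c} := isOpen_lt Complex.continuous_re continuous_const
  have hderiv : ∀ m z, z.re < c → HasDerivAt (G m) (G (m + 1) z) z := fun m z hz =>
    hasDerivAt_integral_pow_mul_exp_mul hcont hint m hz
  have hiter : ∀ m z, z.re < c → iteratedDeriv m (G 0) z = G m z := by
    intro m
    induction m with
    | zero => intro z _; simp
    | succ m ih =>
      intro z hz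
      rw [iteratedDeriv_succ]
      have h1 : iteratedDeriv m (G 0) =ᶠ[𝓝 z] G m := by
        filter_upwards [hopen.mem_nhds hz] with w hw using ih w hw
      rw [h1.deriv_eq, (hderiv m z hz).deriv]
  have hdiff : DifferentiableOn ℂ (G 0) {z : ℂ | z.re < c} := fun z hz =>
    (hderiv 0 z hz).differentiableAt.differentiableWithinAt
  have hball : Metric.ball (0 : ℂ) c ⊆ {z : ℂ | z.re < c} := fun z hz =>
    (Complex.re_le_norm z).trans_lt (mem_ball_zero_iff.1 hz)
  have hev : G 0 =ᶠ[𝓝 0] 0 := by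
    filter_upwards [Metric.ball_mem_nhds (0 : ℂ) hc] with z hz
    rw [← Complex.taylorSeries_eq_on_ball (hdiff.mono hball) hz]
    have h0 : ∀ n, iteratedDeriv n (G 0) 0 = 0 := fun n => by
      rw [hiter n 0 (by simpa using hc)]
      simpa [hG] using hmom n
    simp [h0]
  have hzero : EqOn (G 0) 0 {z : ℂ | z.re < c} :=
    (hdiff.analyticOnNhd hopen).eqOn_zero_of_preconnected_of_eventuallyEq_zero
      (convex_halfSpace_re_lt c).isPreconnected (by simpa using hc) hev
  have hfour : FourierTransform.fourier ((Ioi (0 : ℝ)).indicator h) = 0 := by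
    ext w
    rw [Real.fourier_eq']
    have h1 := hzero (x := -(2 * Real.pi * w) * Complex.I) (by simpa using hc)
    simp only [hG, pow_zero, one_mul, Pi.zero_apply] at h1
    rw [Pi.zero_apply, ← h1, ← integral_indicator measurableSet_Ioi]
    congr 1
    ext v
    by_cases hv : v ∈ Ioi (0 : ℝ)
    · simp only [indicator_of_mem hv, smul_eq_mul]
      congr 2
      simp
      ring
    · simp [indicator_of_notMem hv]
  have hI : Integrable ((Ioi (0 : ℝ)).indicator h) := by
    rw [integrable_indicator_iff measurableSet_Ioi]
    simpa using integrableOn_pow_mul_exp_mul hcont hint 0 (z := 0) (by simpa using hc)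
  have hev2 : (Ioi (0 : ℝ)).indicator h =ᶠ[𝓝 v] h := by
    filter_upwards [Ioi_mem_nhds hv] with w hw using indicator_of_mem hw _
  have hca : ContinuousAt ((Ioi (0 : ℝ)).indicator h) v :=
    (hcont.continuousAt (Ioi_mem_nhds hv)).congr hev2.symm
  have := hI.fourierInv_fourier_eq (by rw [hfour]; exact integrable_zero _ _ _) hca
  rw [hfour, hev2.eq_of_nhds, Real.fourierInv_eq'] at this
  simpa using this.symm

/-- A continuous function on the half-line with enough decay is determined by its moments whose
degree is divisible by `d`. -/
theorem eq_zero_of_forall_moment_mul_eq_zero {d : ℕ} (hd : 1 ≤ d) {g : ℝ → ℂ}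
    (hcont : ContinuousOn g (Ioi 0)) {c : ℝ} (hc : 0 < c)
    (hint : IntegrableOn (fun u : ℝ => Real.exp (c * u ^ d) * ‖g u‖) (Ioi 0))
    (hmom : ∀ m : ℕ, ∫ u in Ioi (0 : ℝ), (u : ℂ) ^ (d * m) * g u = 0) {u : ℝ} (hu : 0 < u) :
    g u = 0 := by
  have hd0 : (d : ℝ) ≠ 0 := by positivity
  set p : ℝ := (d : ℝ)⁻¹ with hp
  have hp0 : 0 < p := by positivity
  have hpow : ∀ v : ℝ, 0 < v → (v ^ p) ^ d = v := fun v hv => by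
    rw [← Real.rpow_natCast, ← Real.rpow_mul hv.le, hp, inv_mul_cancel₀ hd0, Real.rpow_one]
  have key : ∀ v : ℝ, 0 < v → ((|p| * v ^ (p - 1) : ℝ) • g (v ^ p) : ℂ) = 0 := by
    intro v hv
    refine eq_zero_of_forall_moment_eq_zero (h := fun v => (|p| * v ^ (p - 1) : ℝ) • g (v ^ p))
      ?_ hc ?_ ?_ hv
    · refine ContinuousOn.smul (f := fun v : ℝ => |p| * v ^ (p - 1)) ?_
        (hcont.comp ?_ fun x hx => Real.rpow_pos_of_pos (mem_Ioi.1 hx) _)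
      · exact continuousOn_const.mul
          (continuousOn_id.rpow_const fun x hx => Or.inl (ne_of_gt hx))
      · exact continuousOn_id.rpow_const fun x hx => Or.inl (ne_of_gt hx)
    · refine ((integrableOn_Ioi_comp_rpow_iff _ hp0.ne').2 hint).congr_fun (fun x hx => ?_)
        measurableSet_Ioi
      have : 0 ≤ |p| * x ^ (p - 1) := mul_nonneg (abs_nonneg _) (Real.rpow_nonneg (le_of_lt hx) _)
      simp only [norm_smul, Real.norm_of_nonneg this, smul_eq_mul, hpow x hx]
      ring
    · intro m
      rw [← hmom m, ← integral_comp_rpow_Ioi (fun u : ℝ => (u : ℂ) ^ (d * m) * g u) hp0.ne']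
      refine setIntegral_congr_fun measurableSet_Ioi fun x hx => ?_
      have : ((x ^ p : ℝ) : ℂ) ^ (d * m) = (x : ℂ) ^ m := by
        rw [pow_mul, ← Complex.ofReal_pow, hpow x hx]
      simp only [this, mul_smul_comm]
  have h1 := key (u ^ d) (by positivity)
  rw [smul_eq_zero, or_iff_right (by positivity), hp, Real.pow_rpow_inv_natCast hu.le (by omega)]
    at h1
  exact h1

theorem exists_mul_pow_le_add_mul_pow {k d : ℕ} (hkd : k < d) {A ε : ℝ} (hA : 0 ≤ A) (hε : 0 < ε) :
    ∃ C : ℝ, ∀ u : ℝ, 0 ≤ u → A * u ^ k ≤ C + ε * u ^ d := by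
  refine ⟨A * (max 1 (A / ε)) ^ k, fun u hu => ?_⟩
  rcases le_total u (max 1 (A / ε)) with h | h
  · have h1 : A * u ^ k ≤ A * (max 1 (A / ε)) ^ k := by gcongr
    have h2 : 0 ≤ ε * u ^ d := by positivity
    linarith
  · have h1 : 1 ≤ u := (le_max_left _ _).trans h
    have h2 : A ≤ ε * u := by
      rw [← div_le_iff₀' hε]
      exact (le_max_right _ _).trans h
    have h3 : A * u ^ k ≤ ε * u ^ d := calc
      A * u ^ k ≤ ε * u * u ^ k := by gcongr
      _ = ε * u ^ (k + 1) := by ring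
      _ ≤ ε * u ^ d := by gcongr; omega
    have h4 : 0 ≤ A * (max 1 (A / ε)) ^ k := by positivity
    linarith

theorem exists_norm_sum_mul_pow_le {d : ℕ} (s : Finset ℕ) (hs : ∀ k ∈ s, k < d) (a : ℕ → ℂ) {ε : ℝ}
    (hε : 0 < ε) :
    ∃ C : ℝ, ∀ t : ℂ, ‖∑ k ∈ s, a k * t ^ k‖ ≤ C + ε * ‖t‖ ^ d := by
  induction s using Finset.induction_on generalizing ε with
  | empty => exact ⟨0, fun t => by simp; positivity⟩
  | insert k s hk ih =>
    obtain ⟨C₁, h₁⟩ := ih (fun j hj => hs j (Finset.mem_insert_of_mem hj)) (half_pos hε)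
    obtain ⟨C₂, h₂⟩ := exists_mul_pow_le_add_mul_pow (hs k (Finset.mem_insert_self k s))
      (norm_nonneg (a k)) (half_pos hε)
    refine ⟨C₂ + C₁, fun t => ?_⟩
    rw [Finset.sum_insert hk]
    refine (norm_add_le _ _).trans ?_
    rw [norm_mul, norm_pow]
    linarith [h₁ t, h₂ ‖t‖ (norm_nonneg t)]

theorem continuous_P0 (d : ℕ) (a : ℕ → ℂ) : Continuous (P0 d a) := by
  unfold P0
  fun_prop

theorem hasDerivAt_P0 {d : ℕ} (hd : 1 ≤ d) (a : ℕ → ℂ) (t : ℂ) :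
    HasDerivAt (P0 d a) (-t ^ (d - 1) + ∑ k ∈ Finset.Ico 1 d, a k * (k * t ^ (k - 1))) t := by
  have hd0 : (d : ℂ) ≠ 0 := by exact_mod_cast (by omega : d ≠ 0)
  have h1 : HasDerivAt (fun t : ℂ => -t ^ d / (d : ℂ)) (-t ^ (d - 1)) t := by
    convert! ((hasDerivAt_pow d t).neg).div_const (d : ℂ) using 1
    field_simp
  have h2 : HasDerivAt (fun t : ℂ => ∑ k ∈ Finset.Ico 1 d, a k * t ^ k)
      (∑ k ∈ Finset.Ico 1 d, a k * (k * t ^ (k - 1))) t :=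
    HasDerivAt.fun_sum fun k _ => (hasDerivAt_pow k t).const_mul (a k)
  exact h1.add h2

theorem exists_norm_exp_P0_le {d : ℕ} (hd : 1 ≤ d) (a : ℕ → ℂ) :
    ∃ C : ℝ, ∀ ω : ℂ, ω ^ d = 1 → ∀ u : ℝ, 0 < u →
      ‖Complex.exp (P0 d a (ω * u))‖ ≤ Real.exp (C - 1 / (2 * d) * u ^ d) := by
  have hd0 : (0 : ℝ) < d := by positivity
  obtain ⟨C, hC⟩ := exists_norm_sum_mul_pow_le (d := d) (Finset.Ico 1 d)
    (fun k hk => (Finset.mem_Ico.1 hk).2) a (ε := 1 / (2 * d)) (by positivity)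
  refine ⟨C, fun ω hω u hu => ?_⟩
  rw [Complex.norm_exp, Real.exp_le_exp, P0, Complex.add_re]
  have h1 := (Complex.re_le_norm _).trans (hC (ω * u))
  have h2 : -(ω * u : ℂ) ^ d / (d : ℂ) = ((-(u ^ d / d) : ℝ) : ℂ) := by
    rw [mul_pow, hω]
    push_cast
    ring
  have h3 : ‖(ω * u : ℂ)‖ = u := by
    rw [norm_mul, Complex.norm_eq_one_of_pow_eq_one hω (by omega), one_mul, Complex.norm_real,
      Real.norm_of_nonneg hu.le]
  rw [h2, Complex.ofReal_re]
  rw [h3] at h1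
  have h4 : 1 / (2 * (d : ℝ)) * u ^ d = u ^ d / d - 1 / (2 * (d : ℝ)) * u ^ d := by
    field_simp
    ring
  linarith

/-- The integrand of the Omega functions along the ray in direction `ω`. -/
noncomputable def rayIntegrand (d : ℕ) (a : ℕ → ℂ) (ω s : ℂ) (u : ℝ) : ℂ :=
  (u : ℂ) ^ (s - 1) * Complex.exp (P0 d a (ω * u))

theorem continuousOn_rayIntegrand (d : ℕ) (a : ℕ → ℂ) (ω s : ℂ) :
    ContinuousOn (rayIntegrand d a ω s) (Ioi 0) := by
  refine ContinuousOn.mul (fun u hu =>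
    (Complex.continuousAt_ofReal_cpow_const u _ (Or.inr (ne_of_gt hu))).continuousWithinAt) ?_
  have := continuous_P0 d a
  fun_prop

theorem integrableOn_exp_mul_norm_rayIntegrand {d : ℕ} (hd : 1 ≤ d) (a : ℕ → ℂ) {ω s : ℂ}
    (hω : ω ^ d = 1) (hs : 0 < s.re) :
    IntegrableOn (fun u : ℝ => Real.exp (1 / (4 * d) * u ^ d) * ‖rayIntegrand d a ω s u‖)
      (Ioi 0) := by
  have hd0 : (0 : ℝ) < d := by positivity
  obtain ⟨C, hC⟩ := exists_norm_exp_P0_le hd a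
  have h1 := (integrableOn_rpow_mul_exp_neg_mul_rpow (p := d) (s := s.re - 1) (b := 1 / (4 * d))
    (by linarith) hd0 (by positivity)).const_mul (Real.exp C)
  refine Integrable.mono' h1 (ContinuousOn.aestronglyMeasurable
    (ContinuousOn.mul (by fun_prop) (continuousOn_rayIntegrand d a ω s).norm)
    measurableSet_Ioi) ?_
  filter_upwards [ae_restrict_mem measurableSet_Ioi] with u hu
  have hu0 : 0 < u := hu
  rw [norm_mul, norm_norm, Real.norm_of_nonneg (Real.exp_pos _).le, rayIntegrand, norm_mul,
    Complex.norm_cpow_eq_rpow_re_of_pos hu0, Complex.sub_re, Complex.one_re, Real.rpow_natCast]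
  calc Real.exp (1 / (4 * d) * u ^ d) * (u ^ (s.re - 1) * ‖Complex.exp (P0 d a (ω * u))‖)
      ≤ Real.exp (1 / (4 * d) * u ^ d) *
          (u ^ (s.re - 1) * Real.exp (C - 1 / (2 * d) * u ^ d)) := by
        gcongr
        exact hC ω hω u hu0
    _ = u ^ (s.re - 1) * (Real.exp (1 / (4 * d) * u ^ d) *
          Real.exp (C - 1 / (2 * d) * u ^ d)) := by ring
    _ = u ^ (s.re - 1) * (Real.exp C * Real.exp (-(1 / (4 * d)) * u ^ d)) := by
        rw [← Real.exp_add, ← Real.exp_add]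
        congr 2
        field_simp
        ring
    _ = _ := by ring

theorem integrableOn_rayIntegrand {d : ℕ} (hd : 1 ≤ d) (a : ℕ → ℂ) {ω s : ℂ}
    (hω : ω ^ d = 1) (hs : 0 < s.re) : IntegrableOn (rayIntegrand d a ω s) (Ioi 0) := by
  refine Integrable.mono' (integrableOn_exp_mul_norm_rayIntegrand hd a hω hs)
    ((continuousOn_rayIntegrand d a ω s).aestronglyMeasurable measurableSet_Ioi) ?_
  filter_upwards [ae_restrict_mem measurableSet_Ioi] with u hu
  have hu0 : 0 < u := hu
  exact le_mul_of_one_le_left (norm_nonneg _) (Real.one_le_exp (by positivity))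

theorem rayIntegrand_add_natCast (d : ℕ) (a : ℕ → ℂ) (ω s : ℂ) (n : ℕ) {u : ℝ} (hu : 0 < u) :
    rayIntegrand d a ω (s + n) u = (u : ℂ) ^ n * rayIntegrand d a ω s u := by
  have hu0 : (u : ℂ) ≠ 0 := by exact_mod_cast hu.ne'
  rw [rayIntegrand, rayIntegrand, ← mul_assoc, add_sub_right_comm, Complex.cpow_add _ _ hu0,
    Complex.cpow_natCast]
  ring

theorem integral_rayIntegrand_recurrence {d : ℕ} (hd : 1 ≤ d) (a : ℕ → ℂ) {ω s : ℂ}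
    (hω : ω ^ d = 1) (hs : 0 < s.re) :
    ω ^ d * ∫ u in Ioi (0 : ℝ), rayIntegrand d a ω (s + d) u =
      s * (∫ u in Ioi (0 : ℝ), rayIntegrand d a ω s u) +
        ∑ k ∈ Finset.Ico 1 d, k * a k *
          (ω ^ k * ∫ u in Ioi (0 : ℝ), rayIntegrand d a ω (s + k) u) := by
  have hs0 : s ≠ 0 := fun h => by simp [h] at hs
  have hI : ∀ n : ℕ, IntegrableOn (rayIntegrand d a ω (s + n)) (Ioi 0) := fun n =>
    integrableOn_rayIntegrand hd a hω (by simpa using by positivity)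
  have hI0 : IntegrableOn (rayIntegrand d a ω s) (Ioi 0) := integrableOn_rayIntegrand hd a hω hs
  set f : ℝ → ℂ := fun u => (u : ℂ) ^ s * Complex.exp (P0 d a (ω * u)) with hf
  set f' : ℝ → ℂ := fun u => s * rayIntegrand d a ω s u +
    (∑ k ∈ Finset.Ico 1 d, k * a k * (ω ^ k * rayIntegrand d a ω (s + k) u)
      - ω ^ d * rayIntegrand d a ω (s + d) u) with hf'
  have hfI : IntegrableOn f (Ioi 0) := by
    have := integrableOn_rayIntegrand hd a hω (s := s + 1) (by simpa using by positivity)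
    refine this.congr_fun (fun u _ => ?_) measurableSet_Ioi
    simp only [hf, rayIntegrand, add_sub_cancel_right]
  have hsumI : IntegrableOn (fun u => ∑ k ∈ Finset.Ico 1 d,
      k * a k * (ω ^ k * rayIntegrand d a ω (s + k) u)) (Ioi 0) :=
    integrable_finsetSum _ fun k _ => ((hI k).const_mul _).const_mul _
  have hf'I : IntegrableOn f' (Ioi 0) :=
    (hI0.const_mul _).add (hsumI.sub ((hI d).const_mul _))
  have hderiv : ∀ u ∈ Ioi (0 : ℝ), HasDerivAt f (f' u) u := by
    intro u hu
    have hu0 : 0 < u := hu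
    have huc : (u : ℂ) ≠ 0 := by exact_mod_cast hu0.ne'
    have hcp : (u : ℂ) ^ s = u * (u : ℂ) ^ (s - 1) := by
      rw [Complex.cpow_sub _ _ huc, Complex.cpow_one]
      field_simp
    have h1 := hasDerivAt_ofReal_cpow_const hu0.ne' hs0
    have h2 : HasDerivAt (fun u : ℝ => ω * (u : ℂ)) (ω * 1) u :=
      (Complex.ofRealCLM.hasDerivAt (x := u)).const_mul ω
    have h3 := ((hasDerivAt_P0 hd a (ω * u)).comp u h2).cexp
    convert! h1.mul h3 using 1
    have hpow : ∀ k : ℕ, 1 ≤ k → ω ^ k * (u : ℂ) ^ k = ω * u * (ω * u) ^ (k - 1) := by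
      intro k hk
      rw [← mul_pow, mul_pow_sub_one (by omega)]
    have hr : ∀ k : ℕ, 1 ≤ k → ω ^ k * rayIntegrand d a ω (s + k) u =
        (ω * u) ^ (k - 1) * (ω * (f u)) := by
      intro k hk
      rw [rayIntegrand_add_natCast d a ω s k hu0, ← mul_assoc, hpow k hk, rayIntegrand, hf]
      simp only [hcp]
      ring
    have hsum : ∑ k ∈ Finset.Ico 1 d, k * a k * (ω ^ k * rayIntegrand d a ω (s + k) u) =
        (∑ k ∈ Finset.Ico 1 d, a k * (k * (ω * u) ^ (k - 1))) * (ω * f u) := by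
      rw [Finset.sum_mul]
      refine Finset.sum_congr rfl fun k hk => ?_
      rw [hr k (Finset.mem_Ico.1 hk).1]
      ring
    simp only [hf', hsum, hr d hd]
    simp only [rayIntegrand, hf, Function.comp]
    ring
  have hcont : ContinuousWithinAt f (Ici 0) 0 := by
    refine ContinuousAt.continuousWithinAt
      (ContinuousAt.mul (Complex.continuousAt_ofReal_cpow_const 0 s (Or.inl hs)) ?_)
    have := continuous_P0 d a
    fun_prop
  have key := integral_Ioi_of_hasDerivAt_of_tendsto hcont hderiv hf'I
    (tendsto_zero_of_hasDerivAt_of_integrableOn_Ioi hderiv hf'I hfI)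
  have hf0 : f 0 = 0 := by simp [hf, Complex.zero_cpow hs0]
  rw [hf0, sub_zero] at key
  erw [integral_add (hI0.const_mul _) (hsumI.sub ((hI d).const_mul _)),
    integral_sub' hsumI ((hI d).const_mul _),
    integral_finsetSum _ fun k _ => ((hI k).const_mul _).const_mul _] at key
  simp only [integral_const_mul] at key
  linear_combination -key

theorem OmegaFn_eq (d : ℕ) (a : ℕ → ℂ) (k : ℕ) (s : ℂ) :
    OmegaFn d a k s = Complex.exp (2 * Real.pi * Complex.I * k * s / d) *
      ∫ u in Ioi (0 : ℝ), rayIntegrand d a (Complex.exp (2 * Real.pi * Complex.I * k / d)) s u :=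
  rfl

theorem exp_mul_add_natCast (d k : ℕ) (s : ℂ) (n : ℕ) :
    Complex.exp (2 * Real.pi * Complex.I * k * (s + n) / d) =
      Complex.exp (2 * Real.pi * Complex.I * k * s / d) *
        Complex.exp (2 * Real.pi * Complex.I * k / d) ^ n := by
  rw [← Complex.exp_nat_mul, ← Complex.exp_add]
  congr 1
  ring

theorem exp_two_pi_mul_div_eq_pow (d k : ℕ) :
    Complex.exp (2 * Real.pi * Complex.I * k / d) =
      Complex.exp (2 * Real.pi * Complex.I / d) ^ k := by
  rw [← Complex.exp_nat_mul]
  congr 1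
  ring

theorem exp_two_pi_mul_div_pow_eq_one {d : ℕ} (hd : 1 ≤ d) (k : ℕ) :
    Complex.exp (2 * Real.pi * Complex.I * k / d) ^ d = 1 := by
  rw [exp_two_pi_mul_div_eq_pow, pow_right_comm,
    (Complex.isPrimitiveRoot_exp d (by omega)).pow_eq_one, one_pow]

theorem OmegaFn_recurrence {d : ℕ} (hd : 1 ≤ d) (a : ℕ → ℂ) (k : ℕ) {s : ℂ} (hs : 0 < s.re) :
    OmegaFn d a k (s + d) = s * OmegaFn d a k s +
      ∑ j ∈ Finset.Ico 1 d, j * a j * OmegaFn d a k (s + j) := by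
  have h := integral_rayIntegrand_recurrence hd a (exp_two_pi_mul_div_pow_eq_one hd k) hs
  simp only [OmegaFn_eq, exp_mul_add_natCast]
  rw [mul_assoc, h, mul_add, Finset.mul_sum]
  congr 1
  · ring
  · exact Finset.sum_congr rfl fun j _ => by ring

theorem setOf_forall_ne_neg_natCast_eq :
    {s : ℂ | ∀ n : ℕ, s ≠ -(n : ℂ)} = (range fun n : ℕ => -(n : ℂ))ᶜ := by
  ext s
  simp [eq_comm]

theorem isOpen_setOf_forall_ne_neg_natCast : IsOpen {s : ℂ | ∀ n : ℕ, s ≠ -(n : ℂ)} := by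
  rw [setOf_forall_ne_neg_natCast_eq, isOpen_compl_iff]
  have h := (Homeomorph.neg ℂ).isClosedEmbedding.comp
    (Complex.isometry_ofReal.isClosedEmbedding.comp Nat.isClosedEmbedding_coe_real)
  simpa [Function.comp_def] using h.isClosed_range

theorem isPreconnected_setOf_forall_ne_neg_natCast :
    IsPreconnected {s : ℂ | ∀ n : ℕ, s ≠ -(n : ℂ)} := by
  rw [setOf_forall_ne_neg_natCast_eq]
  exact ((countable_range _).isPathConnected_compl_of_one_lt_rank
    (by rw [Complex.rank_real_complex]; norm_num)).isConnected.isPreconnected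

theorem continuation_recurrence {d : ℕ} (hd : 1 ≤ d) (a : ℕ → ℂ) {k : ℕ} {f : ℂ → ℂ}
    (hdiff : DifferentiableOn ℂ f {s : ℂ | ∀ n : ℕ, s ≠ -(n : ℂ)})
    (hΩ : ∀ s : ℂ, 0 < s.re → f s = OmegaFn d a k s) {s : ℂ} (hs : ∀ n : ℕ, s ≠ -(n : ℂ)) :
    f (s + d) = s * f s + ∑ j ∈ Finset.Ico 1 d, j * a j * f (s + j) := by
  set U := {s : ℂ | ∀ n : ℕ, s ≠ -(n : ℂ)} with hU
  have hmaps : ∀ j : ℕ, MapsTo (fun s : ℂ => s + j) U U := by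
    intro j s hs n hn
    refine hs (n + j) ?_
    push_cast
    linear_combination hn
  have hshift : ∀ j : ℕ, DifferentiableOn ℂ (fun s => f (s + j)) U := fun j =>
    hdiff.comp (by fun_prop) (hmaps j)
  have hD : DifferentiableOn ℂ (fun s => f (s + d) -
      (s * f s + ∑ j ∈ Finset.Ico 1 d, j * a j * f (s + j))) U :=
    (hshift d).sub ((differentiableOn_id.mul hdiff).add
      (DifferentiableOn.fun_sum fun j _ => (hshift j).const_mul _))
  have hev : (fun s => f (s + d) -
      (s * f s + ∑ j ∈ Finset.Ico 1 d, j * a j * f (s + j))) =ᶠ[𝓝 1] 0 := by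
    filter_upwards [(isOpen_lt continuous_const Complex.continuous_re).mem_nhds
      (show (0 : ℝ) < (1 : ℂ).re by simp)] with w hw
    have hw0 : 0 < w.re := hw
    have h1 : ∀ j : ℕ, f (w + j) = OmegaFn d a k (w + j) := fun j =>
      hΩ _ (by simpa using by positivity)
    simp only [h1, hΩ w hw0, OmegaFn_recurrence hd a k hw0, sub_self, Pi.zero_apply]
  have h1U : (1 : ℂ) ∈ U := fun n hn => by
    have := congrArg Complex.re hn
    simp at this
    linarith [(n.cast_nonneg : (0 : ℝ) ≤ n)]
  exact sub_eq_zero.1 ((hD.analyticOnNhd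
    isOpen_setOf_forall_ne_neg_natCast).eqOn_zero_of_preconnected_of_eventuallyEq_zero
    isPreconnected_setOf_forall_ne_neg_natCast h1U hev hs)

/-- No nontrivial linear combination of the Omega functions vanishes on a translate of `ℕ`. -/
theorem eq_zero_of_forall_sum_mul_OmegaFn_eq_zero {d : ℕ} (hd : 1 ≤ d) (a : ℕ → ℂ) {σ : ℂ}
    (hσ : 0 < σ.re) {b : Fin d → ℂ} (hb : ∀ n : ℕ, ∑ k : Fin d, b k * OmegaFn d a k (σ + n) = 0) :
    b = 0 := by
  set ω : ℕ → ℂ := fun k => Complex.exp (2 * Real.pi * Complex.I * k / d) with hω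
  have hωd : ∀ k, ω k ^ d = 1 := exp_two_pi_mul_div_pow_eq_one hd
  set e : ℕ → ℂ := fun k => Complex.exp (2 * Real.pi * Complex.I * k * σ / d) with he
  set w : Fin d → ℂ := fun k => b k * e k * Complex.exp (P0 d a (ω k)) with hw
  have hd0 : (0 : ℝ) < d := by positivity
  have hvan : ∀ j : ℕ, ∑ k : Fin d, w k * ω k ^ j = 0 := by
    intro j
    have hσj : 0 < (σ + j).re := by simpa using by positivity
    have hcont : ContinuousOn
        (fun u => ∑ k : Fin d, b k * e k * ω k ^ j * rayIntegrand d a (ω k) (σ + j) u) (Ioi 0) :=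
      continuousOn_finsetSum _ fun k _ =>
        continuousOn_const.mul (continuousOn_rayIntegrand d a (ω k) (σ + j))
    have hexp : ContinuousOn (fun u : ℝ => Real.exp (1 / (4 * d) * u ^ d)) (Ioi 0) := by fun_prop
    have hg := eq_zero_of_forall_moment_mul_eq_zero hd
      (g := fun u => ∑ k : Fin d, b k * e k * ω k ^ j * rayIntegrand d a (ω k) (σ + j) u)
      (c := 1 / (4 * d)) hcont (by positivity) ?_ ?_ one_pos
    · rw [← hg]
      refine Finset.sum_congr rfl fun k _ => ?_
      simp only [hw, rayIntegrand, Complex.ofReal_one, Complex.one_cpow, mul_one]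
      ring
    · have hdom : IntegrableOn (fun u : ℝ => ∑ k : Fin d, ‖b k * e k * ω k ^ j‖ *
          (Real.exp (1 / (4 * d) * u ^ d) * ‖rayIntegrand d a (ω k) (σ + j) u‖)) (Ioi 0) :=
        integrable_finsetSum _ fun k _ =>
          (integrableOn_exp_mul_norm_rayIntegrand hd a (hωd k) hσj).const_mul _
      refine Integrable.mono' hdom
        ((hexp.mul hcont.norm).aestronglyMeasurable measurableSet_Ioi) (Eventually.of_forall fun u => ?_)
      rw [norm_mul, norm_norm, Real.norm_of_nonneg (Real.exp_pos _).le]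
      refine (mul_le_mul_of_nonneg_left (norm_sum_le _ _) (Real.exp_pos _).le).trans_eq ?_
      rw [Finset.mul_sum]
      refine Finset.sum_congr rfl fun k _ => ?_
      rw [norm_mul]
      ring
    · intro m
      have hI : ∀ k : Fin d, IntegrableOn (fun u => b k * e k * ω k ^ j *
          rayIntegrand d a (ω k) (σ + ((j + d * m : ℕ) : ℂ)) u) (Ioi 0) := fun k =>
        (integrableOn_rayIntegrand hd a (hωd k) (by simpa using by positivity)).const_mul _
      calc ∫ u in Ioi (0 : ℝ), (u : ℂ) ^ (d * m) *
            ∑ k : Fin d, b k * e k * ω k ^ j * rayIntegrand d a (ω k) (σ + j) u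
          = ∫ u in Ioi (0 : ℝ), ∑ k : Fin d, b k * e k * ω k ^ j *
              rayIntegrand d a (ω k) (σ + ((j + d * m : ℕ) : ℂ)) u := by
            refine setIntegral_congr_fun measurableSet_Ioi fun u hu => ?_
            simp only [Finset.mul_sum]
            refine Finset.sum_congr rfl fun k _ => ?_
            rw [Nat.cast_add, ← add_assoc, rayIntegrand_add_natCast d a _ _ (d * m) hu]
            ring
        _ = ∑ k : Fin d, b k * OmegaFn d a k (σ + ((j + d * m : ℕ) : ℂ)) := by
            rw [integral_finsetSum _ fun k _ => hI k]
            refine Finset.sum_congr rfl fun k _ => ?_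
            have h1 : ω k ^ (j + d * m) = ω k ^ j := by
              rw [pow_add, pow_mul, hωd, one_pow, mul_one]
            rw [integral_const_mul, OmegaFn_eq, exp_mul_add_natCast]
            change _ = b k * (e k * ω k ^ (j + d * m) * _)
            rw [h1]
            ring
        _ = 0 := hb _
  have hinj : Function.Injective fun k : Fin d => ω k := by
    intro k l hkl
    simp only [hω, exp_two_pi_mul_div_eq_pow] at hkl
    exact Fin.ext ((Complex.isPrimitiveRoot_exp d (by omega)).pow_inj k.2 l.2 hkl)
  have hw0 : w = 0 :=
    Matrix.eq_zero_of_forall_pow_sum_mul_pow_eq_zero hinj fun j => hvan j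
  ext k
  simpa [hw, he, Complex.exp_ne_zero] using congrFun hw0 k

/-- For every `s ∉ {-1,-2,…}`, the determinant of the `d×d` matrix with entries
`F_{k-1}(s+l)` (`1 ≤ k,l ≤ d`) is nonzero, where `F_k` is the meromorphic continuation of
`Ω_k`. -/
theorem stmt9 (d : ℕ) (hd : 1 ≤ d) (a : ℕ → ℂ) (F : ℕ → ℂ → ℂ)
    (hFdiff : ∀ k, k ≤ d - 1 →
      DifferentiableOn ℂ (F k) {s : ℂ | ∀ n : ℕ, s ≠ -(n : ℂ)})
    (hFΩ : ∀ k, k ≤ d - 1 → ∀ s : ℂ, 0 < s.re → F k s = OmegaFn d a k s)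
    (s : ℂ) (hs : ∀ n : ℕ, s ≠ -((n : ℂ) + 1)) :
    Matrix.det (Matrix.of fun k l : Fin d => F (k : ℕ) (s + (l : ℕ) + 1)) ≠ 0 := by
  intro hdet
  obtain ⟨b, hb0, hb⟩ := Matrix.exists_vecMul_eq_zero_iff.2 hdet
  have hrow : ∀ n : ℕ, ∑ k : Fin d, b k * F k (s + n + 1) = 0 := by
    intro n
    induction n using Nat.strong_induction_on with
    | _ n ih =>
      rcases lt_or_ge n d with hn | hn
      · simpa [Matrix.vecMul, dotProduct] using congrFun hb ⟨n, hn⟩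
      · obtain ⟨m, rfl⟩ := Nat.exists_eq_add_of_le' hn
        have hrec : ∀ k : Fin d, F k (s + (m + d : ℕ) + 1) = (s + m + 1) * F k (s + m + 1) +
            ∑ j ∈ Finset.Ico 1 d, j * a j * F k (s + (m + j : ℕ) + 1) := by
          intro k
          have h := continuation_recurrence hd a (hFdiff k (by omega)) (hFΩ k (by omega))
            (s := s + m + 1) fun n hn => hs (n + m) (by push_cast; linear_combination hn)
          have hshift : ∀ j : ℕ, s + (m + j : ℕ) + 1 = s + m + 1 + j := fun j => by
            push_cast
            ring
          simp only [hshift, h]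
        simp only [hrec, mul_add, Finset.sum_add_distrib, Finset.mul_sum]
        rw [Finset.sum_comm]
        have h1 : ∑ k : Fin d, b k * ((s + m + 1) * F k (s + m + 1)) = 0 := by
          rw [← mul_zero (s + m + 1), ← ih m (by omega), Finset.mul_sum]
          exact Finset.sum_congr rfl fun k _ => by ring
        have h2 : ∀ j ∈ Finset.Ico 1 d,
            ∑ k : Fin d, b k * (j * a j * F k (s + (m + j : ℕ) + 1)) = 0 := by
          intro j hj
          rw [← mul_zero (j * a j : ℂ), ← ih (m + j) (by have := Finset.mem_Ico.1 hj; omega),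
            Finset.mul_sum]
          exact Finset.sum_congr rfl fun k _ => by ring
        rw [Finset.sum_eq_zero h2, add_zero, ← h1]
  obtain ⟨N, hN⟩ := exists_nat_gt (-s.re)
  have hσ : 0 < (s + N + 1).re := by
    simp only [Complex.add_re, Complex.natCast_re, Complex.one_re]
    linarith
  refine hb0 (eq_zero_of_forall_sum_mul_OmegaFn_eq_zero hd a hσ fun n => ?_)
  rw [← hrow (N + n)]
  refine Finset.sum_congr rfl fun k _ => ?_
  rw [← hFΩ k (by omega) _ (by rw [Complex.add_re, Complex.natCast_re]; positivity)]
  congr 2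
  push_cast
  ring
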